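/- For Lebesgue-almost every y ∈ [0, 2/3], the level set L(y) is finite; that is, the set {y ∈ [0, 2/3] : L(y) is infinite} has Lebesgue measure zero. -/

import Mathlib

open Set MeasureTheory ENNReal

/-- `phi x` is the distance from `x` to the nearest integer. -/
noncomputable def phi (x : ℝ) : ℝ := |x - (round x : ℤ)|

/-- The Takagi function. -/
noncomputable def T (x : ℝ) : ℝ := ∑' n : ℕ, phi (2 ^ n * x) / 2 ^ n

/-- The `n`-th binary digit of `x` (terminating expansion for dyadic rationals). -/
noncomputable def eps (n : ℕ) (x : ℝ) : ℤ := ⌊2 ^ n * x⌋ - 2 * ⌊2 ^ (n - 1) * x⌋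

/-- `D k x = ∑_{j=1}^k (-1)^{ε_j(x)}`, the excess of 0 digits over 1 digits. -/
noncomputable def D (k : ℕ) (x : ℝ) : ℤ := ∑ j ∈ Finset.Icc 1 k, (1 - 2 * eps j x)

/-- The level set of the Takagi function at level `y`. -/
def L (y : ℝ) : Set ℝ := {x | x ∈ Set.Icc (0:ℝ) 1 ∧ T x = y}

/-- `x` is a balanced dyadic rational of order `m`. -/
def BalancedOfOrder (x : ℝ) (m : ℕ) : Prop :=
  x ∈ Set.Ico (0:ℝ) 1 ∧ (∃ k : ℤ, x = (k : ℝ) / 2 ^ (2 * m)) ∧ D (2 * m) x = 0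

/-- The generation of a balanced dyadic rational of order `m`:
the number of indices `1 ≤ j ≤ 2m` with `D j x = 0`. -/
noncomputable def generation (x : ℝ) (m : ℕ) : ℕ :=
  ((Finset.Icc 1 (2 * m)).filter (fun j => D j x = 0)).card

/-- A balanced dyadic rational of order `m` is leading if `D j x ≥ 0` for all `1 ≤ j ≤ 2m`. -/
def Leading (x : ℝ) (m : ℕ) : Prop := ∀ j ∈ Finset.Icc 1 (2 * m), 0 ≤ D j x

/-- The equivalence relation whose classes are the local level sets. -/
def locSetoid : Setoid ℝ where
  r x x' := ∀ n : ℕ, 1 ≤ n → |D n x| = |D n x'|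
  iseqv := ⟨fun _ _ _ => rfl, fun h n hn => (h n hn).symm,
    fun h g n hn => (h n hn).trans (g n hn)⟩

/-- The set of local level sets contained in `L y`: the image of `L y ∩ [0,1)`
under the quotient map of `locSetoid`. -/
def locClasses (y : ℝ) : Set (Quotient locSetoid) :=
  Quotient.mk locSetoid '' (L y ∩ Set.Ico (0:ℝ) 1)

lemma phi_nonneg (x : ℝ) : 0 ≤ phi x := abs_nonneg _

lemma phi_le_half (x : ℝ) : phi x ≤ 1 / 2 := abs_sub_round x

lemma phi_add_natCast (x : ℝ) (m : ℕ) : phi (x + m) = phi x := by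
  simp [phi, round_add_natCast]

lemma phi_neg (x : ℝ) : phi (-x) = phi x := by
  refine le_antisymm ?_ ?_
  · have h := round_le (-x) (-round x)
    have e : |-x - ((-round x : ℤ) : ℝ)| = |x - round x| := by
      rw [← abs_neg]; congr 1; push_cast; ring
    rwa [e] at h
  · have h := round_le x (-round (-x))
    have e : |x - ((-round (-x) : ℤ) : ℝ)| = |-x - round (-x)| := by
      rw [← abs_neg]; congr 1; push_cast; ring
    rwa [e] at h

lemma phi_of_le_half {x : ℝ} (h0 : 0 ≤ x) (h1 : x ≤ 1 / 2) : phi x = x := by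
  have hf : Int.fract x = x := Int.fract_eq_self.2 ⟨h0, by linarith⟩
  rw [phi, abs_sub_round_eq_min, hf, min_eq_left (by linarith)]

lemma phi_of_half_le {x : ℝ} (h0 : 1 / 2 ≤ x) (h1 : x ≤ 1) : phi x = 1 - x := by
  have h := phi_add_natCast (-x) 1
  rw [phi_neg, Nat.cast_one, phi_of_le_half (by linarith) (by linarith)] at h
  linarith

lemma takagi_term_le (x : ℝ) (n : ℕ) : phi (2 ^ n * x) / 2 ^ n ≤ 1 / 2 / 2 ^ n := by
  gcongr
  exact phi_le_half _

lemma summable_takagi (x : ℝ) : Summable fun n : ℕ => phi (2 ^ n * x) / 2 ^ n :=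
  Summable.of_nonneg_of_le (fun n => div_nonneg (phi_nonneg _) (by positivity))
    (takagi_term_le x) (summable_geometric_two' (1 / 2 * 2) |>.congr (by intro n; simp))

lemma T_nonneg (x : ℝ) : 0 ≤ T x :=
  tsum_nonneg fun n => div_nonneg (phi_nonneg _) (by positivity)

lemma T_le_one (x : ℝ) : T x ≤ 1 := by
  have h := hasSum_geometric_two' (1 : ℝ)
  exact ((summable_takagi x).tsum_le_tsum (takagi_term_le x) h.summable).trans_eq h.tsum_eq

lemma T_eq_phi_add (x : ℝ) : T x = phi x + T (2 * x) / 2 := by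
  rw [T, (summable_takagi x).tsum_eq_zero_add, T, ← tsum_div_const]
  simp only [pow_zero, one_mul, div_one]
  congr 1
  refine tsum_congr fun n => ?_
  rw [pow_succ, mul_assoc, div_div]

lemma T_add_natCast (x : ℝ) (m : ℕ) : T (x + m) = T x := by
  refine tsum_congr fun n => ?_
  have := phi_add_natCast (2 ^ n * x) (2 ^ n * m)
  push_cast at this
  rw [mul_add, this]

lemma T_neg (x : ℝ) : T (-x) = T x :=
  tsum_congr fun n => by rw [mul_neg, phi_neg]

lemma T_one_sub (x : ℝ) : T (1 - x) = T x := by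
  have := T_add_natCast (-x) 1
  rw [T_neg, Nat.cast_one] at this
  rw [← this]; congr 1; ring

lemma T_zero : T 0 = 0 := by
  have := T_eq_phi_add 0
  rw [phi_of_le_half le_rfl (by norm_num), mul_zero] at this
  linarith

lemma T_natCast (m : ℕ) : T m = 0 := by
  simpa [T_zero] using T_add_natCast 0 m

/-- The slope of the `n`-th partial sum of the Takagi series on `[k / 2 ^ n, (k + 1) / 2 ^ n]`. -/
def dyadicSlope : ℕ → ℕ → ℤ
  | 0, _ => 0
  | n + 1, k => dyadicSlope n (k / 2) + (1 - 2 * (k % 2 : ℕ))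

lemma slope_succ_even (n q : ℕ) : dyadicSlope (n + 1) (2 * q) = dyadicSlope n q + 1 := by
  simp [dyadicSlope]

lemma slope_succ_odd (n q : ℕ) : dyadicSlope (n + 1) (2 * q + 1) = dyadicSlope n q - 1 := by
  have h1 : (2 * q + 1) / 2 = q := by omega
  have h2 : (2 * q + 1) % 2 = 1 := by omega
  simp [dyadicSlope, h1, h2]; ring

lemma slope_sub_one_le (n k : ℕ) : dyadicSlope n (k / 2) - 1 ≤ dyadicSlope (n + 1) k := by
  have : k % 2 < 2 := Nat.mod_lt _ (by norm_num)
  simp only [dyadicSlope]; omega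

/-- The Takagi function on a dyadic interval is a linear function plus a scaled copy of itself. -/
lemma T_dyadic (n : ℕ) : ∀ (k : ℕ) {t : ℝ}, 0 ≤ t → t ≤ 1 →
    T ((k + t) / 2 ^ n) = T (k / 2 ^ n) + (dyadicSlope n k * t + T t) / 2 ^ n := by
  induction n with
  | zero =>
    intro k t _ _
    simp [dyadicSlope, T_natCast, add_comm (k : ℝ) t, T_add_natCast]
  | succ n ih =>
    intro k t h0 h1
    obtain ⟨q, rfl | rfl⟩ := Nat.even_or_odd' k
    · have e : ((2 * q : ℕ) + t) / 2 ^ (n + 1) = (q + t / 2) / 2 ^ n := by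
        push_cast; rw [pow_succ]; field_simp
      have e' : ((2 * q : ℕ) : ℝ) / 2 ^ (n + 1) = q / 2 ^ n := by
        push_cast; rw [pow_succ]; field_simp
      rw [e, e', ih q (by linarith) (by linarith), T_eq_phi_add (t / 2),
        phi_of_le_half (by linarith) (by linarith), mul_div_cancel₀ t two_ne_zero,
        slope_succ_even, pow_succ]
      push_cast
      field_simp
      ring
    · have e : ((2 * q + 1 : ℕ) + t) / 2 ^ (n + 1) = (q + (1 + t) / 2) / 2 ^ n := by
        push_cast; rw [pow_succ]; field_simp; ring
      have e' : ((2 * q + 1 : ℕ) : ℝ) / 2 ^ (n + 1) = (q + 1 / 2) / 2 ^ n := by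
        push_cast; rw [pow_succ]; field_simp
      have hT : T (1 + t) = T t := by simpa [add_comm] using T_add_natCast t 1
      have hT1 : T 1 = 0 := by simpa using T_natCast 1
      rw [e, e', ih q (by linarith) (by linarith), ih q (t := 1 / 2) (by norm_num) (by norm_num),
        T_eq_phi_add ((1 + t) / 2), phi_of_half_le (by linarith) (by linarith),
        mul_div_cancel₀ (1 + t) two_ne_zero, hT, T_eq_phi_add (1 / 2),
        phi_of_half_le le_rfl (by norm_num), mul_div_cancel₀ (1 : ℝ) two_ne_zero, hT1,
        slope_succ_odd, pow_succ]
      push_cast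
      field_simp
      ring

lemma T_dyadic_right (n k : ℕ) :
    T ((k + 1) / 2 ^ n) = T (k / 2 ^ n) + dyadicSlope n k / 2 ^ n := by
  have hT1 : T 1 = 0 := by simpa using T_natCast 1
  simpa [hT1] using T_dyadic n k zero_le_one le_rfl

lemma floor_two_pow_mul (x : ℝ) {j n : ℕ} (h : j ≤ n) :
    ⌊2 ^ j * x⌋₊ = ⌊2 ^ n * x⌋₊ / 2 ^ (n - j) := by
  rw [← Nat.floor_div_natCast]
  congr 1
  obtain ⟨d, rfl⟩ := Nat.exists_eq_add_of_le h
  rw [Nat.add_sub_cancel_left, pow_add]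
  push_cast
  field_simp

lemma floor_two_pow_succ_div_two (x : ℝ) (n : ℕ) :
    ⌊2 ^ (n + 1) * x⌋₊ / 2 = ⌊2 ^ n * x⌋₊ := by
  simpa using (floor_two_pow_mul x (Nat.le_succ n)).symm

lemma exists_eq_floor_add_div {x : ℝ} (hx : 0 ≤ x) (n : ℕ) :
    ∃ t : ℝ, 0 ≤ t ∧ t < 1 ∧ x = (⌊2 ^ n * x⌋₊ + t) / 2 ^ n := by
  refine ⟨2 ^ n * x - ⌊2 ^ n * x⌋₊, ?_, ?_, ?_⟩
  · exact sub_nonneg.2 (Nat.floor_le (by positivity))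
  · linarith [Nat.lt_floor_add_one (2 ^ n * x)]
  · field_simp
    ring

/-- If the slopes along the dyadic intervals shrinking to `x` are all positive, then `T x` is at
most the value of `T` at the right endpoint of each of them. -/
lemma T_le_right_endpoint {x : ℝ} (hx : 0 ≤ x) {n : ℕ}
    (h : ∀ j, n ≤ j → 0 < dyadicSlope j ⌊2 ^ j * x⌋₊) :
    T x ≤ T ((⌊2 ^ n * x⌋₊ + 1) / 2 ^ n) := by
  have step : ∀ j, n ≤ j →
      T ((⌊2 ^ j * x⌋₊ + 1) / 2 ^ j) ≤ T ((⌊2 ^ n * x⌋₊ + 1) / 2 ^ n) := by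
    intro j hj
    induction j, hj using Nat.le_induction with
    | base => exact le_rfl
    | succ j hj ih =>
      refine le_trans ?_ ih
      have hfl := floor_two_pow_succ_div_two x j
      have hs := h j hj
      set q := ⌊2 ^ j * x⌋₊
      obtain hk | hk : ⌊2 ^ (j + 1) * x⌋₊ = 2 * q ∨ ⌊2 ^ (j + 1) * x⌋₊ = 2 * q + 1 := by omega
      · rw [hk, T_dyadic_right, T_dyadic_right, slope_succ_even]
        have e' : ((2 * q : ℕ) : ℝ) / 2 ^ (j + 1) = q / 2 ^ j := by
          push_cast; rw [pow_succ]; field_simp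
        have hs' : (1 : ℝ) ≤ dyadicSlope j q := by exact_mod_cast hs
        rw [e', add_le_add_iff_left, pow_succ, div_le_div_iff₀ (by positivity) (by positivity)]
        push_cast
        nlinarith [pow_pos (two_pos (α := ℝ)) j]
      · rw [hk]
        apply le_of_eq
        congr 1
        push_cast; rw [pow_succ]; field_simp; ring
  have near : ∀ j, n ≤ j → T x ≤ T ((⌊2 ^ n * x⌋₊ + 1) / 2 ^ n) + (1 / 2) ^ j := by
    intro j hj
    obtain ⟨t, ht0, ht1, hxt⟩ := exists_eq_floor_add_div hx j
    have hs : (1 : ℝ) ≤ dyadicSlope j ⌊2 ^ j * x⌋₊ := by exact_mod_cast h j hj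
    have h1 := T_dyadic j ⌊2 ^ j * x⌋₊ ht0 ht1.le
    rw [← hxt] at h1
    have h2 := T_dyadic_right j ⌊2 ^ j * x⌋₊
    have h3 : (dyadicSlope j ⌊2 ^ j * x⌋₊ * t + T t) / 2 ^ j ≤
        dyadicSlope j ⌊2 ^ j * x⌋₊ / 2 ^ j + (1 / 2) ^ j := by
      rw [div_pow, one_pow, ← add_div]
      gcongr
      · nlinarith
      · exact T_le_one t
    linarith [step j hj]
  refine ge_of_tendsto (x := Filter.atTop)
    (f := fun j : ℕ => T ((⌊2 ^ n * x⌋₊ + 1) / 2 ^ n) + (1 / 2) ^ j) ?_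
    (Filter.eventually_atTop.2 ⟨n, near⟩)
  simpa using (tendsto_pow_atTop_nhds_zero_of_lt_one (r := (1 / 2 : ℝ))
    (by norm_num) (by norm_num)).const_add (T ((⌊2 ^ n * x⌋₊ + 1) / 2 ^ n))

/-- The points of `[0, 1)` all of whose dyadic neighbourhoods carry positive slope. -/
def positiveSlopeSet : Set ℝ :=
  {x | 0 ≤ x ∧ x < 1 ∧ ∀ j, 1 ≤ j → 0 < dyadicSlope j ⌊2 ^ j * x⌋₊}

/-- The set of nonnegative dyadic rationals. -/
def dyadics : Set ℝ := Set.range fun p : ℕ × ℕ => (p.2 : ℝ) / 2 ^ p.1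

lemma exists_floor_ne {x x' : ℝ} (hx : 0 ≤ x) (h : x < x') :
    ∃ n : ℕ, ⌊2 ^ n * x⌋₊ ≠ ⌊2 ^ n * x'⌋₊ := by
  obtain ⟨n, hn⟩ := exists_pow_lt_of_lt_one (sub_pos.2 h) (by norm_num : (1 / 2 : ℝ) < 1)
  refine ⟨n, fun e => ?_⟩
  obtain ⟨t, ht0, ht1, hxt⟩ := exists_eq_floor_add_div hx n
  obtain ⟨t', ht0', ht1', hxt'⟩ := exists_eq_floor_add_div (hx.trans h.le) n
  rw [← e] at hxt'
  have : x' - x = (t' - t) * (1 / 2) ^ n := by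
    rw [hxt', hxt, div_pow, one_pow, ← sub_div]
    conv_rhs => rw [mul_one_div]
    congr 1
    rw [← hxt]; ring
  nlinarith [pow_pos (by norm_num : (0 : ℝ) < 1 / 2) n]

lemma T_lt_of_mem_positiveSlopeSet {x x' : ℝ} (hx : x ∈ positiveSlopeSet)
    (hx' : x' ∈ positiveSlopeSet) (hd : x' ∉ dyadics) (h : x < x') : T x < T x' := by
  obtain ⟨h0, h1, hs⟩ := hx
  obtain ⟨h0', h1', hs'⟩ := hx'
  have hex := exists_floor_ne h0 h
  classical
  obtain ⟨N, hN, hmin⟩ : ∃ N : ℕ, ⌊2 ^ N * x⌋₊ ≠ ⌊2 ^ N * x'⌋₊ ∧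
      ∀ m < N, ⌊2 ^ m * x⌋₊ = ⌊2 ^ m * x'⌋₊ :=
    ⟨Nat.find hex, Nat.find_spec hex, fun m hm => not_not.1 (Nat.find_min hex hm)⟩
  rcases N with _ | n
  · exact absurd (by simp [Nat.floor_eq_zero.2 h1, Nat.floor_eq_zero.2 h1']) hN
  have hk := hmin n n.lt_succ_self
  have hd1 := floor_two_pow_succ_div_two x n
  have hd2 := floor_two_pow_succ_div_two x' n
  have hle : ⌊2 ^ (n + 1) * x⌋₊ ≤ ⌊2 ^ (n + 1) * x'⌋₊ := by gcongr
  have hsucc : ⌊2 ^ (n + 1) * x'⌋₊ = ⌊2 ^ (n + 1) * x⌋₊ + 1 := by omega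
  have hb := T_le_right_endpoint h0 (n := n + 1) fun j hj => hs j (by omega)
  have hpos := hs' (n + 1) (by omega)
  obtain ⟨t, ht0, ht1, hxt⟩ := exists_eq_floor_add_div h0' (n + 1)
  have ht : 0 < t := by
    refine lt_of_le_of_ne ht0 fun e => hd ⟨(n + 1, ⌊2 ^ (n + 1) * x'⌋₊), ?_⟩
    rw [← e, add_zero] at hxt
    exact hxt.symm
  have hf := T_dyadic (n + 1) ⌊2 ^ (n + 1) * x'⌋₊ ht0 ht1.le
  rw [← hxt] at hf
  have hc : ((⌊2 ^ (n + 1) * x'⌋₊ : ℕ) : ℝ) = ⌊2 ^ (n + 1) * x⌋₊ + 1 := by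
    rw [hsucc]; push_cast; rfl
  have hpos' : (0 : ℝ) < dyadicSlope (n + 1) ⌊2 ^ (n + 1) * x'⌋₊ := by exact_mod_cast hpos
  have : 0 < (dyadicSlope (n + 1) ⌊2 ^ (n + 1) * x'⌋₊ * t + T t) / 2 ^ (n + 1) :=
    div_pos (add_pos_of_pos_of_nonneg (mul_pos hpos' ht) (T_nonneg t)) (by positivity)
  rw [← hc] at hb
  linarith

/-- The pairs `(n, k)` such that `[k / 2 ^ n, (k + 1) / 2 ^ n)` is contained in `[0, 1 / 2)`, carries
slope zero, and is contained in no larger dyadic interval with nonpositive slope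
other than `[0, 1)`. -/
def humps : Set (ℕ × ℕ) :=
  {p | 1 ≤ p.1 ∧ p.2 < 2 ^ (p.1 - 1) ∧ dyadicSlope p.1 p.2 = 0 ∧
    ∀ j, 1 ≤ j → j < p.1 → 0 < dyadicSlope j (p.2 / 2 ^ (p.1 - j))}

/-- The dyadic interval `[k / 2 ^ n, (k + 1) / 2 ^ n)`. -/
def dyadicIco (p : ℕ × ℕ) : Set ℝ := Set.Ico ((p.2 : ℝ) / 2 ^ p.1) ((p.2 + 1) / 2 ^ p.1)

lemma floor_eq_of_mem_dyadicIco {p : ℕ × ℕ} {x : ℝ} (hx : x ∈ dyadicIco p) :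
    ⌊2 ^ p.1 * x⌋₊ = p.2 := by
  obtain ⟨h1, h2⟩ := hx
  rw [div_le_iff₀ (by positivity)] at h1
  rw [lt_div_iff₀ (by positivity)] at h2
  exact (Nat.floor_eq_iff (by nlinarith [Nat.cast_nonneg (α := ℝ) p.2])).2
    ⟨by linarith, by linarith⟩

lemma pairwiseDisjoint_dyadicIco : humps.PairwiseDisjoint dyadicIco := by
  have key : ∀ p ∈ humps, ∀ p' ∈ humps, ∀ x, x ∈ dyadicIco p → x ∈ dyadicIco p' →
      ¬ p.1 < p'.1 := by
    intro p hp p' hp' x hx hx' hlt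
    have := hp'.2.2.2 p.1 hp.1 hlt
    rw [← floor_eq_of_mem_dyadicIco hx', ← floor_two_pow_mul x hlt.le,
      floor_eq_of_mem_dyadicIco hx, hp.2.2.1] at this
    exact lt_irrefl _ this
  intro p hp p' hp' hne
  refine Set.disjoint_left.2 fun x hx hx' => hne ?_
  have h1 : p.1 = p'.1 := le_antisymm (not_lt.1 (key p' hp' p hp x hx' hx))
    (not_lt.1 (key p hp p' hp' x hx hx'))
  refine Prod.ext h1 ?_
  rw [← floor_eq_of_mem_dyadicIco hx, ← floor_eq_of_mem_dyadicIco hx', h1]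

lemma dyadicIco_subset {p : ℕ × ℕ} (hp : p ∈ humps) : dyadicIco p ⊆ Set.Ico 0 (1 / 2) := by
  obtain ⟨n, k⟩ := p
  obtain ⟨h1, h2, -⟩ := hp
  simp only at h1 h2
  obtain ⟨m, rfl⟩ := Nat.exists_eq_add_of_le' h1
  rw [Nat.add_sub_cancel] at h2
  refine Set.Ico_subset_Ico (by positivity) ?_
  have : (k : ℝ) + 1 ≤ 2 ^ m := by exact_mod_cast h2
  rw [div_le_div_iff₀ (by positivity) two_pos, pow_succ]
  linarith

lemma volume_dyadicIco (p : ℕ × ℕ) : volume (dyadicIco p) = ENNReal.ofReal (1 / 2 ^ p.1) := by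
  rw [dyadicIco, Real.volume_Ico]
  congr 1
  ring

lemma tsum_humps_le : ∑' p : humps, ENNReal.ofReal (1 / 2 ^ p.1.1) ≤ ENNReal.ofReal (1 / 2) := by
  calc ∑' p : humps, ENNReal.ofReal (1 / 2 ^ p.1.1)
      = ∑' p : humps, volume (dyadicIco p) := by simp only [volume_dyadicIco]
    _ = volume (⋃ p ∈ humps, dyadicIco p) :=
      (measure_biUnion (Set.to_countable _) pairwiseDisjoint_dyadicIco
        fun _ _ => measurableSet_Ico).symm
    _ ≤ volume (Set.Ico (0 : ℝ) (1 / 2)) :=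
      measure_mono (Set.iUnion₂_subset fun _ hp => dyadicIco_subset hp)
    _ = ENNReal.ofReal (1 / 2) := by rw [Real.volume_Ico, sub_zero]

/-- A point of `[0, 1 / 2)` outside `positiveSlopeSet` lies in one of the humps. -/
lemma exists_hump {x : ℝ} (h0 : 0 ≤ x) (h1 : x < 1 / 2) (hx : x ∉ positiveSlopeSet) :
    ∃ n, (n, ⌊2 ^ n * x⌋₊) ∈ humps := by
  have hex : ∃ j, 1 ≤ j ∧ dyadicSlope j ⌊2 ^ j * x⌋₊ ≤ 0 := by
    by_contra! hcon
    exact hx ⟨h0, by linarith, hcon⟩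
  classical
  obtain ⟨N, ⟨hN1, hN⟩, hmin⟩ : ∃ N, (1 ≤ N ∧ dyadicSlope N ⌊2 ^ N * x⌋₊ ≤ 0) ∧
      ∀ m < N, 1 ≤ m → 0 < dyadicSlope m ⌊2 ^ m * x⌋₊ :=
    ⟨Nat.find hex, Nat.find_spec hex, fun m hm h1m => by
      have := Nat.find_min hex hm
      push Not at this
      exact this h1m⟩
  have hone : dyadicSlope 1 ⌊2 ^ 1 * x⌋₊ = 1 := by
    rw [Nat.floor_eq_zero.2 (by linarith)]; rfl
  obtain ⟨m, rfl⟩ := Nat.exists_eq_add_of_le' hN1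
  refine ⟨m + 1, hN1, ?_, ?_, ?_⟩
  · rw [Nat.floor_lt (by positivity)]
    push_cast
    rw [pow_succ]
    nlinarith [pow_pos (two_pos (α := ℝ)) m]
  · refine le_antisymm hN ?_
    have hm : 1 ≤ m := by
      by_contra hm
      obtain rfl : m = 0 := by omega
      rw [zero_add] at hN
      omega
    have := hmin m m.lt_succ_self hm
    have h2 := slope_sub_one_le m ⌊2 ^ (m + 1) * x⌋₊
    rw [floor_two_pow_succ_div_two] at h2
    simp only
    omega
  · intro j hj hjm
    have := hmin j hjm hj
    rwa [floor_two_pow_mul x hjm.le] at this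

/-- The affine map taking the values of `T` on the hump `p` back to the values of `T` on
`[0, 1)`. -/
noncomputable def unscale (p : ℕ × ℕ) (y : ℝ) : ℝ := 2 ^ p.1 * (y - T (p.2 / 2 ^ p.1))

lemma volume_preimage_unscale (p : ℕ × ℕ) (s : Set ℝ) :
    volume (unscale p ⁻¹' s) = ENNReal.ofReal (1 / 2 ^ p.1) * volume s := by
  have : unscale p ⁻¹' s =
      (fun y => y + -T (p.2 / 2 ^ p.1)) ⁻¹' ((fun y => (2 : ℝ) ^ p.1 * y) ⁻¹' s) := by
    ext y; simp [unscale, sub_eq_add_neg]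
  rw [this, measure_preimage_add_right, Real.volume_preimage_mul_left (by positivity),
    abs_of_pos (by positivity), one_div]

lemma exists_unscale {x y : ℝ} (h0 : 0 ≤ x) (hy : T x = y) {n : ℕ}
    (hn : (n, ⌊2 ^ n * x⌋₊) ∈ humps) :
    ∃ t ∈ L (unscale (n, ⌊2 ^ n * x⌋₊) y), x = (⌊2 ^ n * x⌋₊ + t) / 2 ^ n := by
  obtain ⟨t, ht0, ht1, hxt⟩ := exists_eq_floor_add_div h0 n
  refine ⟨t, ⟨⟨ht0, ht1.le⟩, ?_⟩, hxt⟩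
  have hf := T_dyadic n ⌊2 ^ n * x⌋₊ ht0 ht1.le
  have hs : dyadicSlope n ⌊2 ^ n * x⌋₊ = 0 := hn.2.2.1
  rw [← hxt, hy, hs] at hf
  rw [unscale, hf]
  field_simp
  ring

lemma mem_Icc_of_mem_L {x y : ℝ} (h : x ∈ L y) : y ∈ Set.Icc (0 : ℝ) 1 :=
  h.2 ▸ ⟨T_nonneg x, T_le_one x⟩

lemma finite_L {y : ℝ} (hd : y ∉ T '' dyadics)
    (hfin : {p : humps | y ∈ unscale p ⁻¹' Set.Icc 0 1}.Finite)
    (hL : ∀ p : humps, (L (unscale p y)).Finite) : (L y).Finite := by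
  have hX : (L y ∩ positiveSlopeSet).Finite := by
    refine Set.Subsingleton.finite fun x hx x' hx' => ?_
    have hnd : ∀ z ∈ L y, z ∉ dyadics := fun z hz hzd => hd ⟨z, hzd, hz.2⟩
    by_contra hne
    rcases lt_or_gt_of_ne hne with h | h
    · have := T_lt_of_mem_positiveSlopeSet hx.2 hx'.2 (hnd x' hx'.1) h
      rw [hx.1.2, hx'.1.2] at this
      exact lt_irrefl _ this
    · have := T_lt_of_mem_positiveSlopeSet hx'.2 hx.2 (hnd x hx.1) h
      rw [hx.1.2, hx'.1.2] at this
      exact lt_irrefl _ this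
  have hH : (⋃ p ∈ {p : humps | y ∈ unscale p ⁻¹' Set.Icc 0 1},
      (fun t : ℝ => (p.1.2 + t) / 2 ^ p.1.1) '' L (unscale p y)).Finite :=
    hfin.biUnion fun p _ => (hL p).image _
  have half : (L y ∩ Set.Ico 0 (1 / 2)).Finite := by
    refine (hX.union hH).subset fun x ⟨hx, hx0, hx1⟩ => ?_
    by_cases hp : x ∈ positiveSlopeSet
    · exact Or.inl ⟨hx, hp⟩
    · obtain ⟨n, hn⟩ := exists_hump hx0 hx1 hp
      obtain ⟨t, ht, hxt⟩ := exists_unscale hx0 hx.2 hn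
      exact Or.inr (Set.mem_biUnion (x := (⟨_, hn⟩ : humps)) (mem_Icc_of_mem_L ht)
        ⟨t, ht, hxt.symm⟩)
  refine ((half.union (half.image fun x => 1 - x)).union (Set.finite_singleton (1 / 2))).subset
    fun x hx => ?_
  rcases lt_trichotomy x (1 / 2) with h | h | h
  · exact Or.inl (Or.inl ⟨hx, hx.1.1, h⟩)
  · exact Or.inr h
  · refine Or.inl (Or.inr ⟨1 - x, ⟨⟨⟨?_, ?_⟩, (T_one_sub x).trans hx.2⟩, ?_, ?_⟩, by simp⟩) <;>
      linarith [hx.1.1, hx.1.2]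

lemma volume_infinite_L : volume {y : ℝ | (L y).Infinite} = 0 := by
  set B : Set ℝ := {y : ℝ | (L y).Infinite}
  have hsub : B ⊆ Set.Icc 0 1 := fun y hy => mem_Icc_of_mem_L hy.nonempty.some_mem
  have hBfin : volume B ≠ ∞ :=
    ((measure_mono hsub).trans_lt (by simp)).ne
  have hdy : ∀ᵐ y : ℝ, y ∉ T '' dyadics :=
    measure_eq_zero_iff_ae_notMem.1 (((Set.countable_range _).image T).measure_zero volume)
  have hbc : ∀ᵐ y : ℝ, {p : humps | y ∈ unscale p ⁻¹' Set.Icc 0 1}.Finite := by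
    refine ae_finite_setOfPred_mem ?_
    simp only [volume_preimage_unscale, Real.volume_Icc, sub_zero, ENNReal.ofReal_one, mul_one]
    exact (tsum_humps_le.trans_lt ENNReal.ofReal_lt_top).ne
  have hcover : B ≤ᵐ[volume] ⋃ p : humps, unscale p ⁻¹' B := by
    filter_upwards [hdy, hbc] with y h1 h2 hy
    by_contra hcon
    exact hy (finite_L h1 h2 fun p => Set.not_infinite.1 fun hp => hcon (Set.mem_iUnion.2 ⟨p, hp⟩))
  have hle : volume B ≤ ENNReal.ofReal (1 / 2) * volume B :=
    calc volume B ≤ volume (⋃ p : humps, unscale p ⁻¹' B) := measure_mono_ae hcover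
      _ ≤ ∑' p : humps, volume (unscale p ⁻¹' B) := measure_iUnion_le _
      _ = (∑' p : humps, ENNReal.ofReal (1 / 2 ^ p.1.1)) * volume B := by
        simp only [volume_preimage_unscale, ENNReal.tsum_mul_right]
      _ ≤ ENNReal.ofReal (1 / 2) * volume B := by gcongr; exact tsum_humps_le
  by_contra hne
  have hreal := ENNReal.toReal_mono (ENNReal.mul_ne_top ENNReal.ofReal_ne_top hBfin) hle
  rw [ENNReal.toReal_mul, ENNReal.toReal_ofReal (by norm_num)] at hreal
  linarith [ENNReal.toReal_pos hne hBfin]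

theorem stmt5 :
    volume {y : ℝ | y ∈ Set.Icc (0:ℝ) (2/3) ∧ (L y).Infinite} = 0 :=
  measure_mono_null (fun _ hy => hy.2) volume_infinite_L
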